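/- arXiv:2401.06901 — 4 statements merged into one kernel-verified Lean document; each statement's English description precedes it below -/
import Mathlib

section
/- Let X_s ⊂ ℝⁿ be a compact set, F : ℝⁿ → ℝⁿ a locally Lipschitz vector field (the closed-loop field F(x) = f(x) + G(x)u_s(x)), and x : [0,∞) → ℝⁿ a differentiable solution of ẋ(t) = F(x(t)) with x(t) ∈ X_s for all t ≥ 0. Let V : ℝⁿ → ℝ be continuously differentiable and d : ℝⁿ → ℝ continuous with d(y) > 0 for every y in the transitional region X_t := {y ∈ X_s : V(y) ≥ 0}, and suppose ∇V(y)ᵀF(y) + d(y) ≤ 0 for all y ∈ X_t. Then there exists a finite T ≥ 0 with T ≤ max(V(x(0)), 0)/l, where l := min_{y ∈ X_t} d(y) > 0 (setting T = 0 if X_t is empty), such that x(t) ∈ X_n := {y : V(y) ≤ 0} for all t ≥ T. -/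
/-- A function on `[0, ∞)` whose derivative is negative wherever it vanishes stays nonpositive
once it is nonpositive. -/
theorem nonpos_of_deriv_neg_of_eq_zero {g g' : ℝ → ℝ}
    (hg : ∀ t, 0 ≤ t → HasDerivAt g (g' t) t) (hneg : ∀ t, 0 ≤ t → g t = 0 → g' t < 0)
    {s t : ℝ} (hs : 0 ≤ s) (hgs : g s ≤ 0) (hst : s ≤ t) : g t ≤ 0 :=
  image_le_of_deriv_right_lt_deriv_boundary' (B := fun _ => 0) (B' := fun _ => 0)
    (fun r hr => (hg r (hs.trans hr.1)).continuousAt.continuousWithinAt)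
    (fun r hr => (hg r (hs.trans hr.1)).hasDerivWithinAt) hgs continuousOn_const
    (fun r _ => hasDerivWithinAt_const r _ _) (fun r hr h => hneg r (hs.trans hr.1) h)
    (Set.right_mem_Icc.2 hst)

/-- A function on `[0, ∞)` decreasing at rate at least `l > 0` wherever it is nonnegative is
nonpositive from time `max (g 0) 0 / l` on. -/
theorem nonpos_of_deriv_le_neg_of_nonneg {g g' : ℝ → ℝ} {l : ℝ} (hl : 0 < l)
    (hg : ∀ t, 0 ≤ t → HasDerivAt g (g' t) t) (hle : ∀ t, 0 ≤ t → 0 ≤ g t → g' t ≤ -l)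
    {t : ℝ} (ht : max (g 0) 0 / l ≤ t) : g t ≤ 0 := by
  have hT : 0 ≤ max (g 0) 0 / l := div_nonneg (le_max_right _ _) hl.le
  have hneg : ∀ t, 0 ≤ t → g t = 0 → g' t < 0 := fun t ht h => by
    linarith [hle t ht h.ge]
  refine nonpos_of_deriv_neg_of_eq_zero hg hneg hT ?_ ht
  by_contra! hpos
  have hnonneg : ∀ r ∈ Set.Ico 0 (max (g 0) 0 / l), 0 ≤ g r := fun r hr => by
    by_contra! h
    exact hpos.not_ge (nonpos_of_deriv_neg_of_eq_zero hg hneg hr.1 h.le hr.2.le)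
  have hB : ∀ r, HasDerivAt (fun r => g 0 - l * r) (-l) r := fun r => by
    simpa using ((hasDerivAt_id r).const_mul l).const_sub (g 0)
  have key : g (max (g 0) 0 / l) ≤ g 0 - l * (max (g 0) 0 / l) :=
    image_le_of_deriv_right_le_deriv_boundary (B := fun r => g 0 - l * r) (B' := fun _ => -l)
      (fun r hr => (hg r hr.1).continuousAt.continuousWithinAt)
      (fun r hr => (hg r hr.1).hasDerivWithinAt) (by simp)
      (fun r _ => (hB r).continuousAt.continuousWithinAt)
      (fun r _ => (hB r).hasDerivWithinAt) (fun r hr => hle r hr.1 (hnonneg r hr))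
      (Set.right_mem_Icc.2 hT)
  rw [mul_div_cancel₀ _ hl.ne'] at key
  linarith [le_max_left (g 0) 0]

/-- **Finite-time convergence to the nominal region** (Lemma 1).
Trajectories of the locally Lipschitz closed-loop field `F` that remain
in the compact safe set `Xs` and satisfy the dissipation inequality
`∇V(y)ᵀ F(y) + d(y) ≤ 0` on the transitional region
`Xt = {y ∈ Xs | V y ≥ 0}` reach the nominal region `Xn = {V ≤ 0}` in
finite time `T ≤ max (V (x 0)) 0 / l`, where `l = min_{y ∈ Xt} d y > 0`
(with `T = 0` if `Xt` is empty), and stay there. -/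
theorem finite_time_convergence {n : ℕ}
    (Xs : Set (Fin n → ℝ)) (hXs : IsCompact Xs)
    (F : (Fin n → ℝ) → (Fin n → ℝ)) (hF : LocallyLipschitz F)
    (x : ℝ → (Fin n → ℝ))
    (hx : ∀ t : ℝ, 0 ≤ t → HasDerivAt x (F (x t)) t)
    (hxXs : ∀ t : ℝ, 0 ≤ t → x t ∈ Xs)
    (V : (Fin n → ℝ) → ℝ) (hV : ContDiff ℝ 1 V)
    (d : (Fin n → ℝ) → ℝ) (hd : Continuous d)
    (Xt : Set (Fin n → ℝ)) (hXt : Xt = {y ∈ Xs | 0 ≤ V y})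
    (hdpos : ∀ y ∈ Xt, 0 < d y)
    (hdiss : ∀ y ∈ Xt, fderiv ℝ V y (F y) + d y ≤ 0) :
    (Xt.Nonempty → 0 < sInf (d '' Xt)) ∧
    ∃ T : ℝ, 0 ≤ T ∧
      (Xt.Nonempty → T ≤ max (V (x 0)) 0 / sInf (d '' Xt)) ∧
      (Xt = ∅ → T = 0) ∧
      ∀ t : ℝ, T ≤ t → x t ∈ {y | V y ≤ 0} := by
  have hXtc : IsCompact Xt := by
    rw [hXt]
    exact hXs.inter_right (isClosed_le continuous_const hV.continuous)
  have hmem : ∀ t, 0 ≤ t → 0 ≤ V (x t) → x t ∈ Xt := fun t ht h => by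
    rw [hXt]
    exact ⟨hxXs t ht, h⟩
  have hl : Xt.Nonempty → 0 < sInf (d '' Xt) := fun hne => by
    obtain ⟨y, hy, hyd⟩ := hXtc.exists_sInf_image_eq hne hd.continuousOn
    exact hyd ▸ hdpos y hy
  refine ⟨hl, ?_⟩
  rcases Xt.eq_empty_or_nonempty with hempty | hne
  · refine ⟨0, le_rfl, fun h => absurd hempty h.ne_empty, fun _ => rfl, fun t ht => ?_⟩
    by_contra h
    have := hmem t ht (not_le.1 h).le
    simp [hempty] at this
  · refine ⟨_, div_nonneg (le_max_right _ _) (hl hne).le, fun _ => le_rfl,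
      fun h => absurd h hne.ne_empty, fun t ht => ?_⟩
    have hg : ∀ t, 0 ≤ t → HasDerivAt (fun t => V (x t)) (fderiv ℝ V (x t) (F (x t))) t :=
      fun t ht => ((hV.differentiable one_ne_zero (x t)).hasFDerivAt).comp_hasDerivAt t (hx t ht)
    refine nonpos_of_deriv_le_neg_of_nonneg (hl hne) hg (fun t ht h => ?_) ht
    have hxt := hmem t ht h
    have hinf : sInf (d '' Xt) ≤ d (x t) :=
      csInf_le (hXtc.image hd).bddBelow (Set.mem_image_of_mem d hxt)
    linarith [hdiss _ hxt]
end

section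
/- Let g : [0,∞) → ℝ be differentiable and l > 0 be such that g'(t) ≤ -l for every t ≥ 0 with g(t) ≥ 0. Then g(t) ≤ 0 for all t ≥ max(g(0), 0)/l. In particular, if g(T) ≤ 0 for some T ≥ 0, then g(t) ≤ 0 for all t ≥ T. -/
/-- **Scalar differential-inequality argument for finite-time convergence.**
If `g : [0,∞) → ℝ` is differentiable with derivative `g'` satisfying
`g' t ≤ -l` (with `l > 0`) whenever `t ≥ 0` and `g t ≥ 0`, then
`g t ≤ 0` for all `t ≥ max (g 0) 0 / l`; in particular, if `g T ≤ 0` for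
some `T ≥ 0` then `g t ≤ 0` for all `t ≥ T`. -/
theorem scalar_finite_time_decay (g g' : ℝ → ℝ) (l : ℝ) (hl : 0 < l)
    (hg : ∀ t : ℝ, 0 ≤ t → HasDerivAt g (g' t) t)
    (hdecay : ∀ t : ℝ, 0 ≤ t → 0 ≤ g t → g' t ≤ -l) :
    (∀ t : ℝ, max (g 0) 0 / l ≤ t → g t ≤ 0) ∧
    (∀ T : ℝ, 0 ≤ T → g T ≤ 0 → ∀ t : ℝ, T ≤ t → g t ≤ 0) := by
  have invariant : ∀ T : ℝ, 0 ≤ T → g T ≤ 0 → ∀ t : ℝ, T ≤ t → g t ≤ 0 := by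
    intro T hT hgT t hTt
    refine image_le_of_deriv_right_lt_deriv_boundary (a := T) (b := t) (f := g) (f' := g')
      (B := fun _ => 0) (B' := fun _ => 0)
      (fun x hx => (hg x (hT.trans hx.1)).continuousAt.continuousWithinAt)
      (fun x hx => (hg x (hT.trans hx.1)).hasDerivWithinAt) hgT
      (fun x => hasDerivAt_const x 0) ?_ ⟨hTt, le_rfl⟩
    intro x hx hx0
    have := hdecay x (hT.trans hx.1) hx0.ge
    linarith
  refine ⟨fun t ht => ?_, invariant⟩
  have ht0 : 0 ≤ t := (div_nonneg (le_max_right _ _) hl.le).trans ht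
  by_contra! hpos
  have hgpos : ∀ s : ℝ, 0 ≤ s → s ≤ t → 0 < g s := fun s hs hst =>
    lt_of_not_ge fun h => hpos.not_ge (invariant s hs h t hst)
  have hB : ∀ x : ℝ, HasDerivAt (fun s => g 0 - l * s) (-l) x := fun x => by
    simpa using ((hasDerivAt_id x).const_mul l).const_sub (g 0)
  have hle : g t ≤ g 0 - l * t :=
    image_le_of_deriv_right_le_deriv_boundary (a := 0) (b := t) (f := g) (f' := g')
      (B := fun s => g 0 - l * s) (B' := fun _ => -l)
      (fun x hx => (hg x hx.1).continuousAt.continuousWithinAt)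
      (fun x hx => (hg x hx.1).hasDerivWithinAt) (by simp)
      (fun x _ => (hB x).continuousAt.continuousWithinAt)
      (fun x _ => (hB x).hasDerivWithinAt)
      (fun x hx => hdecay x hx.1 (hgpos x hx.1 hx.2.le).le) ⟨ht0, le_rfl⟩
  have hmax : max (g 0) 0 ≤ t * l := (div_le_iff₀ hl).mp ht
  linarith [le_max_left (g 0) 0]
end

section
/- Let f ∈ (ℝ[x₁,…,x_n])ⁿ, G ∈ (ℝ[x₁,…,x_n])^{n×m}, B₁,…,B_t, V, s, d ∈ ℝ[x₁,…,x_n], p ∈ (ℝ[x₁,…,x_n])ᵐ, and u_n ∈ (ℝ[x₁,…,x_n])ᵐ, with s(x) > 0 for all x ∈ ℝⁿ. Suppose: (i) for every i = 1,…,t, −∇B_iᵀ(s f + G p) ∈ M(B_i, −B₁, …, −B_t); (ii) −∇Vᵀ(s f + G p) − s·d ∈ M(V, −B₁, …, −B_t); (iii) −∇Vᵀ(f + G u_n) − d ∈ M(V, −V). Define u_SOS(x) := p(x)/s(x). Then: (a) for every x ∈ X_s and every i with B_i(x) = 0, ∇B_i(x)ᵀ(f(x) + G(x)u_SOS(x))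 ≤ 0; (b) for every x ∈ X_t, ∇V(x)ᵀ(f(x) + G(x)u_SOS(x)) + d(x) ≤ 0; (c) for every x with V(x) = 0, ∇V(x)ᵀ(f(x) + G(x)u_n(x)) + d(x) ≤ 0. -/
open MvPolynomial

/-- A polynomial is a sum of squares. -/
def IsSOS {σ : Type*} (p : MvPolynomial σ ℝ) : Prop :=
  ∃ (k : ℕ) (q : Fin k → MvPolynomial σ ℝ), p = ∑ i, (q i) ^ 2

/-- Membership in the quadratic module generated by the family `f`. -/
def InQuadModule {σ : Type*} {N : ℕ} (f : Fin N → MvPolynomial σ ℝ)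
    (p : MvPolynomial σ ℝ) : Prop :=
  ∃ (γ₀ : MvPolynomial σ ℝ) (γ : Fin N → MvPolynomial σ ℝ),
    IsSOS γ₀ ∧ (∀ i, IsSOS (γ i)) ∧ p = γ₀ + ∑ i, γ i * f i

theorem IsSOS.eval_nonneg {σ : Type*} {p : MvPolynomial σ ℝ} (hp : IsSOS p) (x : σ → ℝ) :
    0 ≤ eval x p := by
  obtain ⟨k, q, rfl⟩ := hp
  simp only [map_sum, map_pow]
  positivity

theorem InQuadModule.eval_nonneg {σ : Type*} {N : ℕ} {f : Fin N → MvPolynomial σ ℝ}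
    {p : MvPolynomial σ ℝ} (hp : InQuadModule f p) {x : σ → ℝ} (hf : ∀ i, 0 ≤ eval x (f i)) :
    0 ≤ eval x p := by
  obtain ⟨γ₀, γ, h₀, hγ, rfl⟩ := hp
  simp only [map_add, map_sum, map_mul]
  exact add_nonneg (h₀.eval_nonneg x)
    (Finset.sum_nonneg fun i _ => mul_nonneg ((hγ i).eval_nonneg x) (hf i))

theorem sum_mul_add_eq_mul_sum_div {K ι κ : Type*} [Field K] [Fintype ι] [Fintype κ]
    {s : K} (hs : s ≠ 0) (a f : ι → K) (G : ι → κ → K) (p : κ → K) :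
    ∑ j, a j * (s * f j + ∑ k, G j k * p k) =
      s * ∑ j, a j * (f j + ∑ k, G j k * (p k / s)) := by
  rw [Finset.mul_sum]
  refine Finset.sum_congr rfl fun j _ => ?_
  have h : ∑ k, G j k * p k = s * ∑ k, G j k * (p k / s) := by
    rw [Finset.mul_sum]
    exact Finset.sum_congr rfl fun k _ => by field_simp
  rw [h]
  ring

/-- **Lemma 2: SOS certificates imply the CBF, CLF and legacy forward-invariance
conditions** for the rational controller `u_SOS(x) = p(x)/s(x)`.
(i) `−∇B_iᵀ(s f + G p) ∈ M(B_i, −B₁, …, −B_t)`,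
(ii) `−∇Vᵀ(s f + G p) − s d ∈ M(V, −B₁, …, −B_t)`,
(iii) `−∇Vᵀ(f + G u_n) − d ∈ M(V, −V)`,
imply (a) the barrier decrease condition on `∂X_s`, (b) the dissipation
condition on `X_t`, and (c) the legacy-controller condition on `∂X_n`. -/
theorem sos_certificates_imply_cbf_clf {n m t : ℕ}
    (f : Fin n → MvPolynomial (Fin n) ℝ)
    (G : Fin n → Fin m → MvPolynomial (Fin n) ℝ)
    (B : Fin t → MvPolynomial (Fin n) ℝ)
    (V s d : MvPolynomial (Fin n) ℝ)
    (p un : Fin m → MvPolynomial (Fin n) ℝ)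
    (hs : ∀ x : Fin n → ℝ, 0 < eval x s)
    (hcbf : ∀ i : Fin t,
      InQuadModule (Fin.cons (B i) (fun j => -(B j)))
        (-(∑ j, pderiv j (B i) * (s * f j + ∑ k, G j k * p k))))
    (hclf : InQuadModule (Fin.cons V (fun j => -(B j)))
        (-(∑ j, pderiv j V * (s * f j + ∑ k, G j k * p k)) - s * d))
    (hnom : InQuadModule ![V, -V]
        (-(∑ j, pderiv j V * (f j + ∑ k, G j k * un k)) - d)) :
    (∀ x : Fin n → ℝ, (∀ j, eval x (B j) ≤ 0) → ∀ i : Fin t, eval x (B i) = 0 →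
        ∑ j, eval x (pderiv j (B i)) *
          (eval x (f j) + ∑ k, eval x (G j k) * (eval x (p k) / eval x s)) ≤ 0) ∧
    (∀ x : Fin n → ℝ, (∀ j, eval x (B j) ≤ 0) → 0 ≤ eval x V →
        ∑ j, eval x (pderiv j V) *
          (eval x (f j) + ∑ k, eval x (G j k) * (eval x (p k) / eval x s))
          + eval x d ≤ 0) ∧
    (∀ x : Fin n → ℝ, eval x V = 0 →
        ∑ j, eval x (pderiv j V) *
          (eval x (f j) + ∑ k, eval x (G j k) * eval x (un k)) + eval x d ≤ 0) := by
  refine ⟨fun x hx i hi => ?_, fun x hx hV => ?_, fun x hV => ?_⟩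
  · have h := (hcbf i).eval_nonneg (x := x)
      (Fin.cases (by simp [hi]) fun j => by simpa using hx j)
    simp only [map_neg, map_sum, map_mul, map_add,
      sum_mul_add_eq_mul_sum_div (hs x).ne'] at h
    exact nonpos_of_mul_nonpos_right (neg_nonneg.mp h) (hs x)
  · have h := hclf.eval_nonneg (x := x)
      (Fin.cases (by simpa using hV) fun j => by simpa using hx j)
    simp only [map_sub, map_neg, map_sum, map_mul, map_add,
      sum_mul_add_eq_mul_sum_div (hs x).ne'] at h
    refine nonpos_of_mul_nonpos_right (a := eval x s) ?_ (hs x)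
    linarith
  · have h := hnom.eval_nonneg (x := x) (by simp [Fin.forall_fin_two, hV])
    simp only [map_sub, map_neg, map_sum, map_mul, map_add] at h
    linarith
end

section
/- Let f : ℝⁿ → ℝⁿ and G : ℝⁿ → ℝ^{n×m} be smooth, let B₁,…,B_t and V : ℝⁿ → ℝ be smooth, let u_n : ℝⁿ → ℝᵐ be smooth, let d : ℝⁿ → ℝ be smooth, and let r₀, r₁, …, r_t : ℝⁿ → ℝ be twice continuously differentiable. Let U = {u ∈ ℝᵐ : A u ≤ b̄, (u − u₀)ᵀ Q_u (u − u₀) ≤ u_max²} with A ∈ ℝ^{l×m}, b̄ ∈ ℝˡ, Q_u positive semidefinite, u_max > 0. Define C(x) ∈ ℝ^{(t+1)×m} with rows ∇V(x)ᵀG(x), ∇B₁(x)ᵀG(x), …, ∇B_t(x)ᵀG(x), and b(x) ∈ ℝ^{t+1} with entries ∇V(x)ᵀf(x) + d(x), ∇B₁(x)ᵀf(x), …, ∇B_t(x)ᵀf(x). Assume: (i) for every x in the safe set X_s = {x : B_i(x) ≤ 0 for all i}, the feasible set S(x) = {u ∈ U : C(x)u + b(x) ≤ r(x)} is nonempty (guaranteed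 by the lower bound r(x) ≥ C(x)u_SOS(x) + b(x) for a feasible controller u_SOS); (ii) the Linear Independence Constraint Qualification holds: at every x and every u, the gradients with respect to u of the active inequality constraints among the rows of C(x)u + b(x) − r(x) ≤ 0, A u − b̄ ≤ 0, and (u − u₀)ᵀ Q_u (u − u₀) − u_max² ≤ 0 are linearly independent. Then the safety filter u_s : X_s → ℝᵐ, where u_s(x) is the unique minimizer of ‖u_n(x) − u‖² over u ∈ S(x), is well-defined and locally Lipschitz continuous on X_s. -/
open scoped NNReal

section ConvexProgram

open Filter Topology

variable {ι E X : Type*} [NormedAddCommGroup E] [InnerProductSpace ℝ E]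

/-- Existence of the metric projection onto a nonempty set cut out by convex inequalities,
characterized by its variational inequality. -/
theorem exists_projection_of_convex_inequalities [FiniteDimensional ℝ E]
    {g : ι → E → ℝ} {a : ι → E → E} (w : E)
    (hconv : ∀ i y z, g i y + inner ℝ (a i y) (z - y) ≤ g i z)
    (hg : ∀ i, Continuous (g i)) (hne : ∃ u, ∀ i, g i u ≤ 0) :
    ∃ u, (∀ i, g i u ≤ 0) ∧ ∀ z, (∀ i, g i z ≤ 0) → inner ℝ (w - u) (z - u) ≤ 0 := by
  have hclosed : IsClosed {u | ∀ i, g i u ≤ 0} := by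
    rw [Set.ofPred_forall]
    exact isClosed_iInter fun i => isClosed_le (hg i) continuous_const
  have hcvx : Convex ℝ {u | ∀ i, g i u ≤ 0} := by
    intro y hy z hz α β hα hβ hαβ i
    have h₁ := mul_le_mul_of_nonneg_left (hconv i (α • y + β • z) y) hα
    have h₂ := mul_le_mul_of_nonneg_left (hconv i (α • y + β • z) z) hβ
    have h₃ : α * inner ℝ (a i (α • y + β • z)) (y - (α • y + β • z))
        + β * inner ℝ (a i (α • y + β • z)) (z - (α • y + β • z)) = 0 := by
      rw [← inner_smul_right, ← inner_smul_right, ← inner_add_right, smul_sub, smul_sub,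
        sub_add_sub_comm, ← add_smul, hαβ, one_smul, sub_self, inner_zero_right]
    have h₄ := mul_nonpos_of_nonneg_of_nonpos hα (hy i)
    have h₅ := mul_nonpos_of_nonneg_of_nonpos hβ (hz i)
    have h₆ : α * g i (α • y + β • z) + β * g i (α • y + β • z) = g i (α • y + β • z) := by
      rw [← add_mul, hαβ, one_mul]
    linarith
  obtain ⟨u, hu, hmin⟩ := exists_norm_eq_iInf_of_complete_convex hne hclosed.isComplete hcvx w
  exact ⟨u, hu, (norm_eq_iInf_iff_real_inner_le_zero hcvx hu).1 hmin⟩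

variable [Fintype ι]

/-- If every gradient of an active constraint has negative inner product with `d`, then small
steps in the direction `d` are strictly feasible. -/
theorem eventually_add_smul_lt_zero {g : ι → E → ℝ} {a : ι → E → E} {u d : E}
    (hconv : ∀ i y z, g i y + inner ℝ (a i y) (z - y) ≤ g i z)
    (hg : ∀ i, Continuous (g i)) (ha : ∀ i, Continuous (a i)) (hu : ∀ i, g i u ≤ 0)
    (hd : ∀ i, g i u = 0 → inner ℝ (a i u) d < 0) :
    ∀ᶠ s : ℝ in 𝓝[>] 0, ∀ i, g i (u + s • d) < 0 := by
  rw [eventually_all]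
  intro i
  have hline : Continuous fun s : ℝ => u + s • d := by fun_prop
  rcases (hu i).lt_or_eq with h | h
  · refine nhdsWithin_le_nhds ?_
    have : ContinuousAt (fun s : ℝ => g i (u + s • d)) 0 := ((hg i).comp hline).continuousAt
    exact this.eventually_lt continuousAt_const (by simpa using h)
  · have hc : ContinuousAt (fun s : ℝ => inner ℝ (a i (u + s • d)) d) 0 :=
      (((ha i).comp hline).inner continuous_const).continuousAt
    have hneg := hc.eventually_lt continuousAt_const (by simpa using hd i h)
    filter_upwards [nhdsWithin_le_nhds hneg, self_mem_nhdsWithin] with s hs hpos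
    have := hconv i (u + s • d) u
    rw [h, sub_add_cancel_left, inner_neg_right, inner_smul_right] at this
    nlinarith [mul_neg_of_pos_of_neg (show 0 < s from hpos) hs]

/-- Distance between two Karush–Kuhn–Tucker points of two nearby projection problems, given a
bound on the multipliers of the second and control of the difference of the multipliers. -/
theorem norm_sub_le_of_multipliers {g g' : ι → E → ℝ} {a a' : ι → E → E} {u u' w w' : E}
    {μ μ' : ι → ℝ} {L Λ M h : ℝ} (hL : 0 ≤ L) (hΛ : 0 ≤ Λ) (hM : 0 ≤ M) (hh : 0 ≤ h)
    (hconv : ∀ i y z, g i y + inner ℝ (a i y) (z - y) ≤ g i z)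
    (hu : ∀ i, g i u ≤ 0) (hu' : ∀ i, g' i u' ≤ 0)
    (hμ : ∀ i, 0 ≤ μ i) (hμ' : ∀ i, 0 ≤ μ' i)
    (hc : ∀ i, μ i * g i u = 0) (hc' : ∀ i, μ' i * g' i u' = 0)
    (hw : w - u = ∑ i, μ i • a i u) (hw' : w' - u' = ∑ i, μ' i • a' i u')
    (hgL : ∀ i, |g i u' - g' i u'| ≤ L * h) (haL : ∀ i, ‖a i u' - a' i u'‖ ≤ L * h)
    (haL' : ∀ i, ‖a i u - a' i u'‖ ≤ L * (h + ‖u' - u‖)) (hwL : ‖w' - w‖ ≤ L * h)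
    (hμΛ : ∑ i, |μ' i| ≤ Λ)
    (hμM : ∑ i, |μ' i - μ i| ≤ M * ‖∑ i, (μ' i - μ i) • a i u‖) :
    ‖u' - u‖ ≤ (L * (1 + Λ) + L * M * (1 + Λ * L) + L * M * (L + Λ * L) + 1) * h := by
  set D := ‖u' - u‖ with hD
  have hD0 : 0 ≤ D := norm_nonneg _
  have hdiff : ∑ i, |μ' i - μ i| ≤ M * (L * h + D + Λ * (L * (h + D))) := by
    refine hμM.trans (mul_le_mul_of_nonneg_left ?_ hM)
    have heq : ∑ i, (μ' i - μ i) • a i u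
        = (w' - w) - (u' - u) + ∑ i, μ' i • (a i u - a' i u') := by
      simp only [sub_smul, smul_sub, Finset.sum_sub_distrib, ← hw, ← hw']
      abel
    have hsum : ‖∑ i, μ' i • (a i u - a' i u')‖ ≤ Λ * (L * (h + D)) := by
      refine (norm_sum_le _ _).trans ((Finset.sum_le_sum (g := fun i => |μ' i| * (L * (h + D)))
        fun i _ => ?_).trans ?_)
      · rw [norm_smul, Real.norm_eq_abs]
        exact mul_le_mul_of_nonneg_left (haL' i) (abs_nonneg _)
      · rw [← Finset.sum_mul]
        exact mul_le_mul_of_nonneg_right hμΛ (by positivity)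
    rw [heq]
    exact (norm_add_le _ _).trans
      (add_le_add ((norm_sub_le _ _).trans (add_le_add hwL le_rfl)) hsum)
  have hterm : ∀ i, μ i * inner ℝ (a i u) (u' - u) - μ' i * inner ℝ (a' i u') (u' - u)
      ≤ |μ' i - μ i| * (L * h) + |μ' i| * (L * h * D) := by
    intro i
    have h₁ := mul_le_mul_of_nonneg_left (hconv i u u') (hμ i)
    have h₂ := mul_le_mul_of_nonneg_left (hconv i u' u) (hμ' i)
    rw [← neg_sub u' u, inner_neg_right] at h₂
    have h₃ := mul_nonpos_of_nonneg_of_nonpos (hμ i) (hu' i)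
    have h₄ := mul_nonpos_of_nonneg_of_nonpos (hμ' i) (hu i)
    have h₅ : -((μ' i - μ i) * (g i u' - g' i u')) ≤ |μ' i - μ i| * (L * h) :=
      (neg_le_abs _).trans
        ((abs_mul _ _).le.trans (mul_le_mul_of_nonneg_left (hgL i) (abs_nonneg _)))
    have h₆ : μ' i * inner ℝ (a i u' - a' i u') (u' - u) ≤ |μ' i| * (L * h * D) := by
      rw [abs_of_nonneg (hμ' i)]
      exact mul_le_mul_of_nonneg_left ((real_inner_le_norm _ _).trans
        (mul_le_mul_of_nonneg_right (haL i) hD0)) (hμ' i)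
    rw [inner_sub_left] at h₆
    have := hc i
    have := hc' i
    nlinarith
  have hsq : D ^ 2 ≤ L * h * D + (M * (L * h + D + Λ * (L * (h + D))) * (L * h)
      + Λ * (L * h * D)) := by
    have heq : D ^ 2 = inner ℝ (w' - w) (u' - u)
        + ∑ i, (μ i * inner ℝ (a i u) (u' - u) - μ' i * inner ℝ (a' i u') (u' - u)) := by
      have hvec : u' - u = (w' - w) + ((w - u) - (w' - u')) := by abel
      rw [hD, ← real_inner_self_eq_norm_sq]
      rw [show (inner ℝ (u' - u) (u' - u) : ℝ)
        = inner ℝ ((w' - w) + ((w - u) - (w' - u'))) (u' - u) by rw [← hvec],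
        inner_add_left, inner_sub_left (w - u), hw, hw', sum_inner, sum_inner,
        Finset.sum_sub_distrib]
      simp only [real_inner_smul_left]
    rw [heq]
    refine add_le_add ((real_inner_le_norm _ _).trans
      (mul_le_mul_of_nonneg_right hwL hD0)) ?_
    refine (Finset.sum_le_sum fun i _ => hterm i).trans ?_
    rw [Finset.sum_add_distrib, ← Finset.sum_mul, ← Finset.sum_mul]
    exact add_le_add (mul_le_mul_of_nonneg_right hdiff (by positivity))
      (mul_le_mul_of_nonneg_right hμΛ (by positivity))
  set α := L * (1 + Λ) + L * M * (1 + Λ * L) with hα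
  set β := L * M * (L + Λ * L) with hβ
  have hα0 : 0 ≤ α := by positivity
  have hβ0 : 0 ≤ β := by positivity
  have hquad : D ^ 2 ≤ α * (h * D) + β * (h * h) := by
    rw [hα, hβ]; nlinarith
  by_contra! hlt
  have hhD : h ≤ D := by nlinarith [mul_nonneg (add_nonneg hα0 hβ0) hh]
  have hDpos : 0 < D := lt_of_le_of_lt (by positivity) hlt
  nlinarith [mul_le_mul_of_nonneg_left hhD (mul_nonneg hβ0 hh), mul_lt_mul_of_pos_right hlt hDpos,
    mul_nonneg hh hD0]

/-- Continuity of the metric projection onto a parametric convex feasible set satisfying a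
Slater-type condition. -/
theorem tendsto_of_variational_inequality [FiniteDimensional ℝ E] [TopologicalSpace X]
    {s : Set X} {w : X → E} {g : ι → X → E → ℝ} {a : ι → X → E → E} {us : X → E} {x₀ : X} {d : E}
    (hconv : ∀ i x y z, g i x y + inner ℝ (a i x y) (z - y) ≤ g i x z)
    (hw : Continuous w) (hg : ∀ i, Continuous fun q : X × E => g i q.1 q.2)
    (ha : ∀ i, Continuous fun q : X × E => a i q.1 q.2)
    (hfeas : ∀ x ∈ s, ∀ i, g i x (us x) ≤ 0)
    (hmin : ∀ x ∈ s, ∀ z, (∀ i, g i x z ≤ 0) → inner ℝ (w x - us x) (z - us x) ≤ 0)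
    (hx₀ : x₀ ∈ s) (hd : ∀ i, g i x₀ (us x₀) = 0 → inner ℝ (a i x₀ (us x₀)) d < 0) :
    Tendsto us (𝓝[s] x₀) (𝓝 (us x₀)) := by
  have hslater : ∀ᶠ σ : ℝ in 𝓝[>] 0, ∀ i, g i x₀ (us x₀ + σ • d) < 0 :=
    eventually_add_smul_lt_zero (hconv · x₀) (fun i => (hg i).comp (Continuous.prodMk_right x₀))
      (fun i => (ha i).comp (Continuous.prodMk_right x₀)) (hfeas x₀ hx₀) hd
  have hvar : ∀ z, (∀ i, g i x₀ z < 0) →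
      ∀ᶠ x in 𝓝[s] x₀, inner ℝ (w x - us x) (z - us x) ≤ 0 := by
    intro z hz
    have : ∀ᶠ x in 𝓝 x₀, ∀ i, g i x z < 0 := eventually_all.2 fun i =>
      ((hg i).comp (Continuous.prodMk_left z)).continuousAt.eventually_lt
        continuousAt_const (hz i)
    filter_upwards [nhdsWithin_le_nhds this, self_mem_nhdsWithin] with x hx hxs
    exact hmin x hxs z fun i => (hx i).le
  obtain ⟨σ₀, hσ₀⟩ := hslater.exists
  set z₀ := us x₀ + σ₀ • d
  have hbdd : ∀ᶠ x in 𝓝[s] x₀,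
      us x ∈ Metric.closedBall (w x₀) (‖z₀ - w x₀‖ + 2) := by
    have hwx : ∀ᶠ x in 𝓝 x₀, ‖w x - w x₀‖ < 1 := by
      simpa [dist_eq_norm] using hw.continuousAt.eventually (Metric.ball_mem_nhds (w x₀) one_pos)
    filter_upwards [nhdsWithin_le_nhds hwx, hvar z₀ hσ₀] with x hx hin
    have hle : ‖w x - us x‖ ≤ ‖z₀ - w x‖ := by
      have hsplit : z₀ - us x = (z₀ - w x) + (w x - us x) := by abel
      rw [hsplit, inner_add_right, real_inner_self_eq_norm_sq] at hin
      have := (abs_le.1 (abs_real_inner_le_norm (w x - us x) (z₀ - w x))).1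
      by_contra! hlt
      nlinarith [norm_nonneg (z₀ - w x)]
    rw [mem_closedBall_iff_norm]
    have h₁ := norm_sub_le_norm_sub_add_norm_sub (us x) (w x) (w x₀)
    have h₂ := norm_sub_le_norm_sub_add_norm_sub z₀ (w x₀) (w x)
    rw [norm_sub_rev (us x) (w x)] at h₁
    rw [norm_sub_rev (w x₀) (w x)] at h₂
    linarith
  refine (isCompact_closedBall _ _).tendsto_nhds_of_unique_mapClusterPt hbdd ?_
  intro y _ hy
  obtain ⟨F, hF, hFy⟩ := mapClusterPt_iff_ultrafilter.1 hy
  have hFx : Tendsto id (F : Filter X) (𝓝 x₀) := hF.trans nhdsWithin_le_nhds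
  have hFs : ∀ᶠ x in (F : Filter X), x ∈ s := hF self_mem_nhdsWithin
  have hFw : Tendsto w (F : Filter X) (𝓝 (w x₀)) := (hw.tendsto x₀).comp hFx
  have hyfeas : ∀ i, g i x₀ y ≤ 0 := by
    intro i
    have : Tendsto (fun x => g i x (us x)) (F : Filter X) (𝓝 (g i x₀ y)) :=
      ((hg i).tendsto (x₀, y)).comp (hFx.prodMk_nhds hFy)
    refine le_of_tendsto this ?_
    filter_upwards [hFs] with x hx using hfeas x hx i
  have h₁ := hmin x₀ hx₀ y hyfeas
  have h₂ : inner ℝ (w x₀ - y) (us x₀ - y) ≤ 0 := by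
    have hcont : Continuous fun σ : ℝ => inner ℝ (w x₀ - y) (us x₀ + σ • d - y) := by fun_prop
    have hlim : Tendsto (fun σ : ℝ => inner ℝ (w x₀ - y) (us x₀ + σ • d - y)) (𝓝[>] 0)
        (𝓝 (inner ℝ (w x₀ - y) (us x₀ - y))) := by
      simpa using (hcont.tendsto 0).mono_left nhdsWithin_le_nhds
    refine le_of_tendsto hlim ?_
    filter_upwards [hslater] with σ hσ
    exact le_of_tendsto ((hFw.sub hFy).inner (tendsto_const_nhds.sub hFy)) (hF (hvar _ hσ))
  have h₃ : inner ℝ (y - us x₀) (y - us x₀) ≤ 0 := by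
    have hs : y - us x₀ = (w x₀ - us x₀) - (w x₀ - y) := by abel
    have hn : y - us x₀ = -(us x₀ - y) := by abel
    have : inner ℝ (y - us x₀) (y - us x₀)
        = inner ℝ (w x₀ - us x₀) (y - us x₀) + inner ℝ (w x₀ - y) (us x₀ - y) := by
      conv_lhs => rw [hs, inner_sub_left, ← hs]
      rw [← neg_sub y (us x₀), inner_neg_right]; ring
    linarith
  exact sub_eq_zero.1 (real_inner_self_nonpos.1 h₃)

variable [DecidableEq ι]

/-- A finite linearly independent family admits a biorthogonal family. -/
theorem LinearIndependent.exists_biorthogonal [FiniteDimensional ℝ E] {p : ι → Prop}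
    {a : ι → E} (h : LinearIndependent ℝ (fun c : {i // p i} => a c)) :
    ∃ v : ι → E, ∀ i j, p i → p j → inner ℝ (a j) (v i) = if j = i then 1 else 0 := by
  classical
  rw [linearIndependent_iff_injective_fintypeLinearCombination] at h
  obtain ⟨φ, hφ⟩ := LinearMap.exists_leftInverse_of_injective _ (LinearMap.ker_eq_bot.2 h)
  refine ⟨fun i => if hi : p i then (InnerProductSpace.toDual ℝ E).symm
    (LinearMap.toContinuousLinearMap (LinearMap.proj ⟨i, hi⟩ ∘ₗ φ)) else 0, ?_⟩
  intro i j hi hj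
  have key := congrFun (LinearMap.congr_fun hφ (Pi.single ⟨j, hj⟩ 1)) ⟨i, hi⟩
  rw [LinearMap.comp_apply, Fintype.linearCombination_apply_single, one_smul] at key
  dsimp only
  rw [dif_pos hi, real_inner_comm, InnerProductSpace.toDual_symm_apply]
  simp only [LinearMap.coe_toContinuousLinearMap', LinearMap.comp_apply, LinearMap.proj_apply]
  rw [key]
  simp [Pi.single_apply, eq_comm]

/-- Under the linear independence constraint qualification there is a direction of strict
decrease for all active constraints. -/
theorem exists_inner_neg_of_biorthogonal {p : ι → Prop} {a v : ι → E}
    (hv : ∀ i j, p i → p j → inner ℝ (a j) (v i) = if j = i then 1 else 0) :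
    ∃ d : E, ∀ i, p i → inner ℝ (a i) d < 0 := by
  classical
  refine ⟨-∑ i, if p i then v i else 0, fun j hj => ?_⟩
  have : ∀ i, inner ℝ (a j) (if p i then v i else 0) = if j = i then (1 : ℝ) else 0 := by
    intro i
    by_cases hi : p i
    · simp only [if_pos hi, hv i j hi hj]
    · have : j ≠ i := by rintro rfl; exact hi hj
      simp [hi, this]
  simp [inner_neg_right, inner_sum, this]

/-- Karush–Kuhn–Tucker conditions for the projection onto a set cut out by convex
inequalities, under the linear independence constraint qualification. -/
theorem exists_multipliers_of_linearIndependent [FiniteDimensional ℝ E]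
    {g : ι → E → ℝ} {a : ι → E → E} {u w : E}
    (hconv : ∀ i y z, g i y + inner ℝ (a i y) (z - y) ≤ g i z)
    (hg : ∀ i, Continuous (g i)) (ha : ∀ i, Continuous (a i)) (hu : ∀ i, g i u ≤ 0)
    (hmin : ∀ z, (∀ i, g i z ≤ 0) → inner ℝ (w - u) (z - u) ≤ 0)
    (hli : LinearIndependent ℝ (fun c : {i // g i u = 0} => a c u)) :
    ∃ μ : ι → ℝ, (∀ i, 0 ≤ μ i) ∧ (∀ i, g i u ≠ 0 → μ i = 0) ∧
      w - u = ∑ i, μ i • a i u := by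
  obtain ⟨v, hv⟩ := LinearIndependent.exists_biorthogonal (a := fun i => a i u) hli
  obtain ⟨d₀, hd₀⟩ := exists_inner_neg_of_biorthogonal hv
  have hstrict : ∀ d, (∀ i, g i u = 0 → inner ℝ (a i u) d < 0) → inner ℝ (w - u) d ≤ 0 := by
    intro d hd
    obtain ⟨s, hs, hpos⟩ :=
      ((eventually_add_smul_lt_zero hconv hg ha hu hd).and self_mem_nhdsWithin).exists
    have := hmin _ fun i => (hs i).le
    rw [add_sub_cancel_left, inner_smul_right] at this
    exact nonpos_of_mul_nonpos_right this hpos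
  have hcone : ∀ d, (∀ i, g i u = 0 → inner ℝ (a i u) d ≤ 0) → inner ℝ (w - u) d ≤ 0 := by
    intro d hd
    have hlim : Tendsto (fun s : ℝ => inner ℝ (w - u) (d + s • d₀)) (𝓝[>] 0)
        (𝓝 (inner ℝ (w - u) d)) := by
      have : Continuous fun s : ℝ => inner ℝ (w - u) (d + s • d₀) := by fun_prop
      simpa using (this.tendsto 0).mono_left nhdsWithin_le_nhds
    refine le_of_tendsto hlim ?_
    filter_upwards [self_mem_nhdsWithin] with s hs
    refine hstrict _ fun i hi => ?_
    rw [inner_add_right, inner_smul_right]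
    nlinarith [hd i hi, mul_neg_of_pos_of_neg (show 0 < s from hs) (hd₀ i hi)]
  refine ⟨fun i => if g i u = 0 then inner ℝ (w - u) (v i) else 0, ?_, ?_, ?_⟩
  · intro i
    dsimp only
    split_ifs with hi
    · have := hcone (-v i) fun j hj => by
        rw [inner_neg_right, hv i j hi hj]; split_ifs <;> norm_num
      rw [inner_neg_right] at this
      linarith
    · rfl
  · intro i hi
    simp [hi]
  · refine ext_inner_right ℝ fun e => ?_
    have hker : ∀ j, g j u = 0 → inner ℝ (a j u)
        (e - ∑ i, if g i u = 0 then inner ℝ (a i u) e • v i else 0) = 0 := by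
      intro j hj
      have : ∀ i, inner ℝ (a j u) (if g i u = 0 then inner ℝ (a i u) e • v i else 0)
          = if j = i then inner ℝ (a i u) e else 0 := by
        intro i
        by_cases hi : g i u = 0
        · rw [if_pos hi, inner_smul_right, hv i j hi hj]; simp
        · have : j ≠ i := by rintro rfl; exact hi hj
          simp [hi, this]
      simp [inner_sub_right, inner_sum, this]
    have h₁ := hcone _ fun j hj => (hker j hj).le
    have h₂ := hcone (-(e - ∑ i, if g i u = 0 then inner ℝ (a i u) e • v i else 0))
      fun j hj => by rw [inner_neg_right, hker j hj, neg_zero]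
    rw [inner_neg_right] at h₂
    have h₃ := le_antisymm h₁ (by linarith)
    rw [inner_sub_right, sub_eq_zero] at h₃
    rw [h₃, inner_sum, sum_inner]
    refine Finset.sum_congr rfl fun i _ => ?_
    dsimp only
    split_ifs with hi
    · rw [inner_smul_right, real_inner_smul_left, mul_comm]
    · simp

/-- Quantitative linear independence: a family that is nearly biorthogonal to `v` has
coefficients controlled by the norm of the linear combination. -/
theorem sum_abs_le_of_nearly_biorthogonal {p : ι → Prop} {a v : ι → E}
    {μ : ι → ℝ} (hμ : ∀ i, ¬ p i → μ i = 0)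
    (hv : ∀ i j, p i → p j →
      |inner ℝ (a j) (v i) - (if j = i then 1 else 0)|
        ≤ 1 / (2 * (Fintype.card ι + 1))) :
    ∑ i, |μ i| ≤ 2 * (∑ i, ‖v i‖) * ‖∑ i, μ i • a i‖ := by
  set w := ∑ i, μ i • a i with hw
  set N : ℝ := (Fintype.card ι : ℝ) with hN
  have hN0 : 0 ≤ N := Nat.cast_nonneg _
  set ε : ℝ := 1 / (2 * (N + 1)) with hε
  have hi : ∀ i, |μ i| ≤ ‖w‖ * ‖v i‖ + ε * ∑ j, |μ j| := by
    intro i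
    by_cases hpi : p i
    · have hsum : μ i = inner ℝ w (v i) - ∑ j, μ j *
          (inner ℝ (a j) (v i) - (if j = i then 1 else 0)) := by
        have : ∑ j, μ j * (if j = i then 1 else 0) = μ i := by
          simp
        simp only [mul_sub, Finset.sum_sub_distrib, this, hw, sum_inner, real_inner_smul_left]
        ring
      have hb : |∑ j, μ j * (inner ℝ (a j) (v i) - (if j = i then 1 else 0))|
          ≤ ε * ∑ j, |μ j| := by
        rw [Finset.mul_sum]
        refine (Finset.abs_sum_le_sum_abs _ _).trans (Finset.sum_le_sum fun j _ => ?_)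
        rw [abs_mul, mul_comm]
        by_cases hpj : p j
        · exact mul_le_mul_of_nonneg_right (hv i j hpi hpj) (abs_nonneg _)
        · simp [hμ j hpj]
      calc |μ i| ≤ |inner ℝ w (v i)| + |∑ j, μ j *
          (inner ℝ (a j) (v i) - (if j = i then 1 else 0))| := by
            conv_lhs => rw [hsum]
            exact abs_sub _ _
        _ ≤ _ := add_le_add (abs_real_inner_le_norm _ _) hb
    · rw [hμ i hpi, abs_zero]
      positivity
  have htot := Finset.sum_le_sum fun i (_ : i ∈ Finset.univ) => hi i
  rw [Finset.sum_add_distrib, ← Finset.mul_sum, Finset.sum_const, Finset.card_univ,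
    nsmul_eq_mul, ← hN] at htot
  have hsmall : N * ε ≤ 1 / 2 := by
    rw [hε, mul_one_div, div_le_div_iff₀ (by positivity) (by positivity)]
    linarith
  have hpos : 0 ≤ ∑ j, |μ j| := Finset.sum_nonneg fun _ _ => abs_nonneg _
  nlinarith [mul_le_mul_of_nonneg_right hsmall hpos]

/-- **Lipschitz stability of the projection onto a parametric convex feasible set.** If the
constraints are convex in `u`, their values and gradients are `C¹` in `(x, u)`, and the gradients
of the active constraints are linearly independent at the projections, then the projection is
locally Lipschitz in the parameter. -/
theorem exists_lipschitzOnWith_of_variational_inequality [FiniteDimensional ℝ E]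
    [NormedAddCommGroup X] [NormedSpace ℝ X]
    {s : Set X} {w : X → E} {g : ι → X → E → ℝ} {a : ι → X → E → E} {us : X → E}
    (hconv : ∀ i x y z, g i x y + inner ℝ (a i x y) (z - y) ≤ g i x z)
    (hw : ContDiff ℝ 1 w) (hg : ∀ i, ContDiff ℝ 1 fun q : X × E => g i q.1 q.2)
    (ha : ∀ i, ContDiff ℝ 1 fun q : X × E => a i q.1 q.2)
    (hfeas : ∀ x ∈ s, ∀ i, g i x (us x) ≤ 0)
    (hmin : ∀ x ∈ s, ∀ z, (∀ i, g i x z ≤ 0) → inner ℝ (w x - us x) (z - us x) ≤ 0)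
    (hli : ∀ x ∈ s, LinearIndependent ℝ
      (fun c : {i // g i x (us x) = 0} => a c x (us x)))
    {x₀ : X} (hx₀ : x₀ ∈ s) :
    ∃ K : ℝ≥0, ∃ W ∈ 𝓝[s] x₀, LipschitzOnWith K us W := by
  have hga : ∀ i x, Continuous (g i x) := fun i x =>
    (hg i).continuous.comp (Continuous.prodMk_right x)
  have haa : ∀ i x, Continuous (a i x) := fun i x =>
    (ha i).continuous.comp (Continuous.prodMk_right x)
  obtain ⟨v, hv⟩ := LinearIndependent.exists_biorthogonal
    (a := fun i => a i x₀ (us x₀)) (hli x₀ hx₀)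
  obtain ⟨d, hd⟩ := exists_inner_neg_of_biorthogonal hv
  have hus : Tendsto us (𝓝[s] x₀) (𝓝 (us x₀)) :=
    tendsto_of_variational_inequality hconv hw.continuous (fun i => (hg i).continuous)
      (fun i => (ha i).continuous) hfeas hmin hx₀ hd
  have hpair : Tendsto (fun x => (x, us x)) (𝓝[s] x₀) (𝓝 (x₀, us x₀)) :=
    (tendsto_id.mono_left nhdsWithin_le_nhds).prodMk_nhds hus
  have hdata : ContDiff ℝ 1 fun q : X × E =>
      ((fun i => g i q.1 q.2, fun i => a i q.1 q.2, w q.1) : (ι → ℝ) × (ι → E) × E) :=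
    (contDiff_pi.2 hg).prodMk ((contDiff_pi.2 ha).prodMk (hw.comp contDiff_fst))
  obtain ⟨L, N, hN, hlip⟩ := (hdata.contDiffAt (x := (x₀, us x₀))).exists_lipschitzOnWith
  obtain ⟨N₁, hN₁, N₂, hN₂, hN₁₂⟩ := mem_nhds_prod_iff.1 hN
  have hlip' : ∀ q ∈ N, ∀ q' ∈ N, (∀ i, |g i q.1 q.2 - g i q'.1 q'.2| ≤ L * ‖q - q'‖) ∧
      (∀ i, ‖a i q.1 q.2 - a i q'.1 q'.2‖ ≤ L * ‖q - q'‖) ∧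
      ‖w q.1 - w q'.1‖ ≤ L * ‖q - q'‖ := by
    intro q hq q' hq'
    have h := hlip.dist_le_mul q hq q' hq'
    rw [dist_eq_norm, dist_eq_norm, Prod.mk_sub_mk, Prod.mk_sub_mk] at h
    obtain ⟨h₁, h₂⟩ := norm_prod_le_iff.1 h
    obtain ⟨h₃, h₄⟩ := norm_prod_le_iff.1 h₂
    exact ⟨fun i => (norm_le_pi_norm _ i).trans h₁, fun i => (norm_le_pi_norm _ i).trans h₃, h₄⟩
  have hinact : ∀ᶠ x in 𝓝[s] x₀, ∀ i, g i x₀ (us x₀) ≠ 0 → g i x (us x) ≠ 0 := by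
    refine eventually_all.2 fun i => eventually_imp_distrib_left.2 fun hi => ?_
    exact (((hg i).continuous.tendsto _).comp hpair).eventually_ne hi
  have hnear : ∀ᶠ x in 𝓝[s] x₀, ∀ i j, g i x₀ (us x₀) = 0 → g j x₀ (us x₀) = 0 →
      |inner ℝ (a j x (us x)) (v i) - (if j = i then 1 else 0)|
        ≤ 1 / (2 * ((Fintype.card ι : ℝ) + 1)) := by
    refine eventually_all.2 fun i => eventually_all.2 fun j =>
      eventually_imp_distrib_left.2 fun hi => eventually_imp_distrib_left.2 fun hj => ?_
    have hlim : Tendsto (fun x => |inner ℝ (a j x (us x)) (v i) - (if j = i then 1 else 0)|)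
        (𝓝[s] x₀) (𝓝 0) := by
      have := ((((ha j).continuous.tendsto _).comp hpair).inner
        (tendsto_const_nhds (x := v i))).sub_const (if j = i then (1 : ℝ) else 0)
      simpa [hv i j hi hj] using this.abs
    exact hlim.eventually_le_const (by positivity)
  have hbdd : ∀ᶠ x in 𝓝[s] x₀, ‖w x - us x‖ ≤ ‖w x₀ - us x₀‖ + 1 := by
    have : Tendsto (fun x => ‖w x - us x‖) (𝓝[s] x₀) (𝓝 ‖w x₀ - us x₀‖) :=
      (((hw.continuous.tendsto x₀).mono_left nhdsWithin_le_nhds).sub hus).norm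
    exact this.eventually_le_const (lt_add_one _)
  set M : ℝ := 2 * ∑ i, ‖v i‖ with hM
  have hM0 : 0 ≤ M := by positivity
  set Λ : ℝ := M * (‖w x₀ - us x₀‖ + 1) with hΛ
  have hΛ0 : 0 ≤ Λ := by positivity
  refine ⟨Real.toNNReal (L * (1 + Λ) + L * M * (1 + Λ * L) + L * M * (L + Λ * L) + 1), _,
    (hinact.and (hnear.and (hbdd.and (((tendsto_id.mono_left nhdsWithin_le_nhds).eventually
      hN₁).and ((hus.eventually hN₂).and self_mem_nhdsWithin))))), ?_⟩
  refine LipschitzOnWith.of_dist_le_mul ?_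
  rintro x' ⟨hin', hne', hb', hx'N, hux'N, hx's⟩ x ⟨hin, hne, -, hxN, huxN, hxs⟩
  have hkkt := fun y hy => exists_multipliers_of_linearIndependent (hconv · y) (hga · y) (haa · y)
    (hfeas y hy) (hmin y hy) (hli y hy)
  obtain ⟨μ, hμ, hc, hws⟩ := hkkt x hxs
  obtain ⟨μ', hμ', hc', hws'⟩ := hkkt x' hx's
  have hsupp : ∀ i, g i x₀ (us x₀) ≠ 0 → μ i = 0 := fun i hi => hc i (hin i hi)
  have hsupp' : ∀ i, g i x₀ (us x₀) ≠ 0 → μ' i = 0 := fun i hi => hc' i (hin' i hi)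
  have hμΛ : ∑ i, |μ' i| ≤ Λ := by
    refine (sum_abs_le_of_nearly_biorthogonal hsupp' hne').trans ?_
    rw [← hws']
    exact mul_le_mul_of_nonneg_left hb' hM0
  have hμM : ∑ i, |μ' i - μ i| ≤ M * ‖∑ i, (μ' i - μ i) • a i x (us x)‖ :=
    sum_abs_le_of_nearly_biorthogonal (fun i hi => by rw [hsupp i hi, hsupp' i hi, sub_zero]) hne
  have hmem : ∀ y ∈ N₁, ∀ z ∈ N₂, (y, z) ∈ N := fun y hy z hz => hN₁₂ ⟨hy, hz⟩
  have hvert : ‖((x, us x') : X × E) - (x', us x')‖ = ‖x' - x‖ := by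
    rw [Prod.mk_sub_mk, sub_self, Prod.norm_mk, norm_zero, max_eq_left (norm_nonneg _),
      norm_sub_rev]
  have hdiag : ‖((x, us x) : X × E) - (x', us x')‖ ≤ ‖x' - x‖ + ‖us x' - us x‖ := by
    rw [Prod.mk_sub_mk, Prod.norm_mk, norm_sub_rev x, norm_sub_rev (us x)]
    exact max_le_add_of_nonneg (norm_nonneg _) (norm_nonneg _)
  obtain ⟨hgL, haL, hwL⟩ := hlip' _ (hmem x hxN _ hux'N) _ (hmem x' hx'N _ hux'N)
  obtain ⟨-, haL', -⟩ := hlip' _ (hmem x hxN _ huxN) _ (hmem x' hx'N _ hux'N)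
  rw [hvert] at hgL haL hwL
  rw [dist_eq_norm, dist_eq_norm, Real.coe_toNNReal _ (by positivity)]
  refine norm_sub_le_of_multipliers L.coe_nonneg hΛ0 hM0 (norm_nonneg _) (hconv · x)
    (hfeas x hxs) (hfeas x' hx's) hμ hμ' (fun i => ?_) (fun i => ?_) hws hws' hgL haL
    (fun i => (haL' i).trans (mul_le_mul_of_nonneg_left hdiag L.coe_nonneg))
    (by rwa [norm_sub_rev]) hμΛ hμM
  · by_cases h : g i x (us x) = 0
    · rw [h, mul_zero]
    · rw [hc i h, zero_mul]
  · by_cases h : g i x' (us x') = 0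
    · rw [h, mul_zero]
    · rw [hc' i h, zero_mul]

end ConvexProgram

/-- First-order convexity inequality for the quadratic form of a positive semidefinite matrix. -/
theorem Matrix.PosSemidef.quadratic_add_gradient_le {m : ℕ} {Q : Matrix (Fin m) (Fin m) ℝ}
    (hQ : Q.PosSemidef) (c y z : Fin m → ℝ) :
    ∑ j, ∑ k, (y j - c j) * Q j k * (y k - c k)
        + ∑ k, (2 * ∑ j, Q k j * (y j - c j)) * (z k - y k)
      ≤ ∑ j, ∑ k, (z j - c j) * Q j k * (z k - c k) := by
  have hnn : 0 ≤ ∑ j, ∑ k, (z j - y j) * Q j k * (z k - y k) := by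
    have := hQ.dotProduct_mulVec_nonneg (z - y)
    simpa [dotProduct, Matrix.mulVec, Finset.mul_sum, mul_assoc] using this
  have hsymm : ∀ j k, Q k j = Q j k := fun j k => by simpa using hQ.1.apply j k
  have hcross : ∑ j, ∑ k, (y j - c j) * Q j k * (z k - y k)
      = ∑ j, ∑ k, (z j - y j) * Q j k * (y k - c k) := by
    rw [Finset.sum_comm]
    refine Finset.sum_congr rfl fun j _ => Finset.sum_congr rfl fun k _ => ?_
    rw [hsymm j k]; ring
  have hgrad : ∑ k, (2 * ∑ j, Q k j * (y j - c j)) * (z k - y k)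
      = 2 * ∑ j, ∑ k, (z j - y j) * Q j k * (y k - c k) := by
    rw [Finset.mul_sum]
    refine Finset.sum_congr rfl fun k _ => ?_
    rw [Finset.mul_sum, Finset.mul_sum, Finset.sum_mul]
    exact Finset.sum_congr rfl fun j _ => by ring
  have hexp : ∑ j, ∑ k, (z j - c j) * Q j k * (z k - c k)
      = ∑ j, ∑ k, (y j - c j) * Q j k * (y k - c k)
        + ∑ j, ∑ k, (y j - c j) * Q j k * (z k - y k)
        + ∑ j, ∑ k, (z j - y j) * Q j k * (y k - c k)
        + ∑ j, ∑ k, (z j - y j) * Q j k * (z k - y k) := by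
    simp only [← Finset.sum_add_distrib]
    exact Finset.sum_congr rfl fun j _ => Finset.sum_congr rfl fun k _ => by ring
  rw [hgrad, hexp]
  linarith

/-- **Theorem 1: local Lipschitz continuity of the QCQP-based advanced safety
filter.** Under smoothness of all the data, feasibility of the QCQP on the
safe set, and the LICQ for the state-dependent CLF/CBF constraints, the
linear input constraints and the quadratic input constraint, the map
`x ↦ u_s(x)` (the unique minimizer of `‖u_n(x) − u‖²` over the feasible set
`S(x)`) is well defined and locally Lipschitz continuous on the safe set. -/
theorem safety_filter_locally_lipschitz {n m t l : ℕ}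
    (f : (Fin n → ℝ) → (Fin n → ℝ)) (hf : ContDiff ℝ (⊤ : ℕ∞) f)
    (G : (Fin n → ℝ) → (Fin n → Fin m → ℝ)) (hG : ContDiff ℝ (⊤ : ℕ∞) G)
    (B : Fin t → (Fin n → ℝ) → ℝ) (hB : ∀ i, ContDiff ℝ (⊤ : ℕ∞) (B i))
    (V : (Fin n → ℝ) → ℝ) (hV : ContDiff ℝ (⊤ : ℕ∞) V)
    (un : (Fin n → ℝ) → (Fin m → ℝ)) (hun : ContDiff ℝ (⊤ : ℕ∞) un)
    (d : (Fin n → ℝ) → ℝ) (hd : ContDiff ℝ (⊤ : ℕ∞) d)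
    (r : Fin (t + 1) → (Fin n → ℝ) → ℝ) (hr : ∀ i, ContDiff ℝ 2 (r i))
    (A : Fin l → Fin m → ℝ) (bbar : Fin l → ℝ)
    (Qu : Matrix (Fin m) (Fin m) ℝ) (hQu : Qu.PosSemidef)
    (u0 : Fin m → ℝ) (umax : ℝ) (humax : 0 < umax)
    (U : Set (Fin m → ℝ))
    (hU : U = {u | (∀ i, ∑ k, A i k * u k ≤ bbar i) ∧
        ∑ j, ∑ k, (u j - u0 j) * Qu j k * (u k - u0 k) ≤ umax ^ 2})
    (Cmat : (Fin n → ℝ) → Fin (t + 1) → (Fin m → ℝ))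
    (hC : ∀ x, Cmat x = Fin.cons (fun k => fderiv ℝ V x (fun j => G x j k))
        (fun i k => fderiv ℝ (B i) x (fun j => G x j k)))
    (bvec : (Fin n → ℝ) → Fin (t + 1) → ℝ)
    (hb : ∀ x, bvec x = Fin.cons (fderiv ℝ V x (f x) + d x)
        (fun i => fderiv ℝ (B i) x (f x)))
    (Xs : Set (Fin n → ℝ)) (hXs : Xs = {x | ∀ i, B i x ≤ 0})
    (S : (Fin n → ℝ) → Set (Fin m → ℝ))
    (hS : ∀ x, S x = {u ∈ U | ∀ i, ∑ k, Cmat x i k * u k + bvec x i ≤ r i x})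
    -- (i) feasibility of the QCQP on the safe set
    (hfeas : ∀ x ∈ Xs, (S x).Nonempty)
    -- (ii) LICQ: the gradients (w.r.t. `u`) of the active inequality
    -- constraints are linearly independent at every `(x, u)`
    (hLICQ : ∀ (x : Fin n → ℝ) (u : Fin m → ℝ),
      LinearIndependent ℝ
        (fun c : {c : Fin (t + 1) ⊕ (Fin l ⊕ Unit) //
            Sum.elim (fun i => ∑ k, Cmat x i k * u k + bvec x i = r i x)
              (Sum.elim (fun i => ∑ k, A i k * u k = bbar i)
                (fun _ => ∑ j, ∑ k, (u j - u0 j) * Qu j k * (u k - u0 k)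
                  = umax ^ 2)) c} =>
          Sum.elim (fun i => Cmat x i)
            (Sum.elim (fun i => A i)
              (fun _ => fun k => 2 * ∑ j, Qu k j * (u j - u0 j))) c.1)) :
    ∃ us : (Fin n → ℝ) → (Fin m → ℝ),
      -- `us x` is the unique minimizer of `‖u_n(x) − u‖²` over `S x`
      (∀ x ∈ Xs, us x ∈ S x ∧
        ∀ u ∈ S x, (∑ k, (un x k - us x k) ^ 2 ≤ ∑ k, (un x k - u k) ^ 2) ∧
          (∑ k, (un x k - u k) ^ 2 ≤ ∑ k, (un x k - us x k) ^ 2 → u = us x)) ∧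
      -- `us` is locally Lipschitz continuous on `Xs`
      (∀ x ∈ Xs, ∃ K : ℝ≥0, ∃ W ∈ nhdsWithin x Xs, LipschitzOnWith K us W) := by
  have hV' : ContDiff ℝ 1 (fderiv ℝ V) := hV.fderiv_right (by norm_cast)
  have hB' : ∀ i, ContDiff ℝ 1 (fderiv ℝ (B i)) :=
    fun i => (hB i).fderiv_right (by norm_cast)
  have hone : (1 : WithTop ℕ∞) ≤ ((⊤ : ℕ∞) : WithTop ℕ∞) := by norm_cast
  have hGk : ∀ k, ContDiff ℝ 1 fun x j => G x j k := fun k =>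
    contDiff_pi.2 fun j => contDiff_pi.1 (contDiff_pi.1 (hG.of_le hone) j) k
  have hCmat : ∀ i k, ContDiff ℝ 1 fun x => Cmat x i k := by
    intro i k
    simp only [hC]
    refine Fin.cases ?_ (fun i => ?_) i
    · simpa only [Fin.cons_zero] using hV'.clm_apply (hGk k)
    · simpa only [Fin.cons_succ] using (hB' i).clm_apply (hGk k)
  have hbvec : ∀ i, ContDiff ℝ 1 fun x => bvec x i := by
    intro i
    simp only [hb]
    refine Fin.cases ?_ (fun i => ?_) i
    · simpa only [Fin.cons_zero] using (hV'.clm_apply (hf.of_le hone)).add (hd.of_le hone)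
    · simpa only [Fin.cons_succ] using (hB' i).clm_apply (hf.of_le hone)
  have hr' : ∀ i, ContDiff ℝ 1 (r i) := fun i => (hr i).of_le (by norm_num)
  let g : Fin (t + 1) ⊕ (Fin l ⊕ Unit) → (Fin n → ℝ) → EuclideanSpace ℝ (Fin m) → ℝ :=
      fun c x u =>
    Sum.elim (fun i => ∑ k, Cmat x i k * u k + bvec x i - r i x)
      (Sum.elim (fun i => ∑ k, A i k * u k - bbar i)
        (fun _ => ∑ j, ∑ k, (u j - u0 j) * Qu j k * (u k - u0 k) - umax ^ 2)) c
  let a : Fin (t + 1) ⊕ (Fin l ⊕ Unit) → (Fin n → ℝ) → EuclideanSpace ℝ (Fin m) →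
      EuclideanSpace ℝ (Fin m) := fun c x u => WithLp.toLp 2
    (Sum.elim (fun i => Cmat x i) (Sum.elim (fun i => A i)
      (fun _ => fun k => 2 * ∑ j, Qu k j * (u j - u0 j))) c)
  let w : (Fin n → ℝ) → EuclideanSpace ℝ (Fin m) := fun x => WithLp.toLp 2 (un x)
  have hmem : ∀ x (u : EuclideanSpace ℝ (Fin m)), u.ofLp ∈ S x ↔ ∀ c, g c x u ≤ 0 := by
    intro x u
    rw [hS, hU]
    simp only [g, Sum.forall, Sum.elim_inl, Sum.elim_inr, Set.mem_ofPred_eq, sub_nonpos,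
      forall_const]
    tauto
  have hinner : ∀ y z : EuclideanSpace ℝ (Fin m), inner ℝ y z = ∑ k, y k * z k := fun y z => by
    simp [PiLp.inner_apply, mul_comm]
  have hconv : ∀ c x y z, g c x y + inner ℝ (a c x y) (z - y) ≤ g c x z := by
    intro c x y z
    rw [hinner]
    rcases c with i | i | _
    · simp only [g, a, Sum.elim_inl, PiLp.sub_apply, mul_sub, Finset.sum_sub_distrib]
      linarith
    · simp only [g, a, Sum.elim_inl, Sum.elim_inr, PiLp.sub_apply, mul_sub,
        Finset.sum_sub_distrib]
      linarith
    · have := hQu.quadratic_add_gradient_le u0 y z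
      simp only [g, a, Sum.elim_inr, PiLp.sub_apply]
      linarith
  have hcoord : ∀ k, ContDiff ℝ 1 fun q : (Fin n → ℝ) × EuclideanSpace ℝ (Fin m) => q.2 k :=
    fun k =>
    contDiff_euclidean.1 contDiff_snd k
  have hg : ∀ c, ContDiff ℝ 1 fun q : (Fin n → ℝ) × EuclideanSpace ℝ (Fin m) => g c q.1 q.2 := by
    rintro (i | i | _)
    · exact ((ContDiff.sum fun k _ => ((hCmat i k).comp contDiff_fst).mul (hcoord k)).add
        ((hbvec i).comp contDiff_fst)).sub ((hr' i).comp contDiff_fst)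
    · exact (ContDiff.sum fun k _ => contDiff_const.mul (hcoord k)).sub contDiff_const
    · exact (ContDiff.sum fun j _ => ContDiff.sum fun k _ =>
        (((hcoord j).sub contDiff_const).mul contDiff_const).mul
          ((hcoord k).sub contDiff_const)).sub contDiff_const
  have ha : ∀ c, ContDiff ℝ 1 fun q : (Fin n → ℝ) × EuclideanSpace ℝ (Fin m) => a c q.1 q.2 := by
    rintro (i | i | _) <;> refine contDiff_euclidean.2 fun k => ?_
    · exact (hCmat i k).comp contDiff_fst
    · exact contDiff_const
    · exact contDiff_const.mul (ContDiff.sum fun j _ =>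
        contDiff_const.mul ((hcoord j).sub contDiff_const))
  have hw : ContDiff ℝ 1 w := PiLp.contDiff_toLp.comp (hun.of_le hone)
  have hli : ∀ x (u : EuclideanSpace ℝ (Fin m)), LinearIndependent ℝ
      (fun c : {c // g c x u = 0} => a c x u) := by
    intro x u
    refine (((hLICQ x u).map' (WithLp.linearEquiv 2 ℝ (Fin m → ℝ)).symm.toLinearMap
      (LinearEquiv.ker _)).comp (fun c : {c // g c x u = 0} => ⟨c.1, ?_⟩) fun c c' h => ?_ :)
    · obtain ⟨i | i | _, hc⟩ := c <;> exact sub_eq_zero.1 hc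
    · exact Subtype.ext (Subtype.ext_iff.1 h :)
  have hproj : ∀ x, ∃ u : EuclideanSpace ℝ (Fin m), x ∈ Xs → (∀ c, g c x u ≤ 0) ∧
      ∀ z, (∀ c, g c x z ≤ 0) → inner ℝ (w x - u) (z - u) ≤ 0 := by
    intro x
    by_cases hx : x ∈ Xs
    · obtain ⟨u, hu⟩ := hfeas x hx
      obtain ⟨p, hp⟩ := exists_projection_of_convex_inequalities (w x) (hconv · x)
        (fun c => (hg c).continuous.comp (Continuous.prodMk_right x))
        ⟨WithLp.toLp 2 u, (hmem x _).1 hu⟩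
      exact ⟨p, fun _ => hp⟩
    · exact ⟨0, fun h => absurd h hx⟩
  choose us hus using hproj
  refine ⟨fun x => (us x).ofLp, fun x hx => ⟨(hmem x _).2 (hus x hx).1, fun u hu => ?_⟩, ?_⟩
  · have hvar := (hus x hx).2 (WithLp.toLp 2 u) ((hmem x _).1 hu)
    rw [hinner] at hvar
    have hexp : ∑ k, (un x k - u k) ^ 2 = ∑ k, (un x k - us x k) ^ 2
        + ∑ k, (u k - us x k) ^ 2 - 2 * ∑ k, (un x k - us x k) * (u k - us x k) := by
      rw [Finset.mul_sum, ← Finset.sum_add_distrib, ← Finset.sum_sub_distrib]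
      exact Finset.sum_congr rfl fun k _ => by ring
    have hvar' : ∑ k, (un x k - us x k) * (u k - us x k) ≤ 0 := hvar
    have hnn : 0 ≤ ∑ k, (u k - us x k) ^ 2 := Finset.sum_nonneg fun _ _ => sq_nonneg _
    refine ⟨by linarith, fun hle => ?_⟩
    have hzero : ∑ k, (u k - us x k) ^ 2 = 0 := le_antisymm (by linarith) hnn
    funext k
    have := (Finset.sum_eq_zero_iff_of_nonneg fun _ _ => sq_nonneg _).1 hzero k (Finset.mem_univ k)
    exact sub_eq_zero.1 (pow_eq_zero_iff two_ne_zero |>.1 this)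
  · intro x hx
    obtain ⟨K, W, hW, hlip⟩ := exists_lipschitzOnWith_of_variational_inequality hconv hw hg ha
      (fun y hy => (hus y hy).1) (fun y hy => (hus y hy).2) (fun y _ => hli y (us y)) hx
    exact ⟨1 * K, W, hW, (PiLp.lipschitzWith_ofLp 2 _).comp_lipschitzOnWith hlip⟩
end
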